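/- Let φ : (0,∞) → (0,∞) satisfy the weak scaling condition with constants a ≥ 1 and 0 < σ̲ ≤ σ̄ < 2. There exists a constant c₂ > 0 depending only on n such that C_φ ≤ a c₂ / (\underline{C}_φ(1) + \overline{C}_φ(1)). -/

import Mathlib

open MeasureTheory Metric Filter Set
open scoped Classical

noncomputable section

abbrev En (n : ℕ) : Type := EuclideanSpace ℝ (Fin n)

def WSC (φ : ℝ → ℝ) (a σl σu : ℝ) : Prop :=
  (∀ r : ℝ, 0 < r → 0 < φ r) ∧
  ∀ r R : ℝ, 0 < r → r ≤ R →
    a⁻¹ * (R / r) ^ σl ≤ φ R / φ r ∧ φ R / φ r ≤ a * (R / r) ^ σu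

def Cund (φ : ℝ → ℝ) (R : ℝ) : ℝ := ∫ r in Ioo (0:ℝ) R, r / φ r

def Cov (φ : ℝ → ℝ) (R : ℝ) : ℝ := ∫ r in Ioi R, 1 / (r * φ r)

def Cphi (n : ℕ) [NeZero n] (φ : ℝ → ℝ) : ℝ :=
  (∫ y : En n, (1 - Real.cos (y 0)) / (‖y‖ ^ n * φ ‖y‖))⁻¹

def dd {n : ℕ} (u : En n → ℝ) (x y : En n) : ℝ := u (x + y) + u (x - y) - 2 * u x

def Mp (n : ℕ) [NeZero n] (φ : ℝ → ℝ) (lam Lam : ℝ) (u : En n → ℝ) (x : En n) : ℝ :=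
  Cphi n φ * ∫ y : En n, (Lam * max (dd u x y) 0 - lam * max (-(dd u x y)) 0) / (‖y‖ ^ n * φ ‖y‖)

def Mm (n : ℕ) [NeZero n] (φ : ℝ → ℝ) (lam Lam : ℝ) (u : En n → ℝ) (x : En n) : ℝ :=
  Cphi n φ * ∫ y : En n, (lam * max (dd u x y) 0 - Lam * max (-(dd u x y)) 0) / (‖y‖ ^ n * φ ‖y‖)

def Bdd {α : Type*} (u : α → ℝ) : Prop := ∃ M : ℝ, ∀ x, |u x| ≤ M

def ViscLE {n : ℕ} (I : (En n → ℝ) → En n → ℝ) (u : En n → ℝ) (Ω : Set (En n))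
    (f : En n → ℝ) : Prop :=
  ∀ x ∈ Ω, ∀ N : Set (En n), IsOpen N → x ∈ N → N ⊆ Ω →
    ∀ ψ : En n → ℝ, ContDiff ℝ 2 ψ → ψ x = u x → (∀ z ∈ N, z ≠ x → ψ z < u z) →
      I (fun z => if z ∈ N then ψ z else u z) x ≤ f x

def ViscGE {n : ℕ} (I : (En n → ℝ) → En n → ℝ) (u : En n → ℝ) (Ω : Set (En n))
    (f : En n → ℝ) : Prop :=
  ∀ x ∈ Ω, ∀ N : Set (En n), IsOpen N → x ∈ N → N ⊆ Ω →
    ∀ ψ : En n → ℝ, ContDiff ℝ 2 ψ → ψ x = u x → (∀ z ∈ N, z ≠ x → u z < ψ z) →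
      f x ≤ I (fun z => if z ∈ N then ψ z else u z) x

def ωn (n : ℕ) : ℝ := (volume (ball (0 : En n) 1)).toReal

def cube (n : ℕ) (R : ℝ) : Set (En n) := {x | ∀ i, |x i| < R / 2}


lemma min_one_sq_le_integral_one_sub_cos (s : ℝ) :
    min 1 (s ^ 2) / 10 ≤ ∫ l in (1:ℝ)..3.1, (1 - Real.cos (l * s)) := by
  by_cases hs : |s| ≤ 1
  · have hle : ∫ _l in (1:ℝ)..3.1, s ^ 2 / 10 ≤ ∫ l in (1:ℝ)..3.1, (1 - Real.cos (l * s)) := by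
      apply intervalIntegral.integral_mono_on (by norm_num)
      · exact intervalIntegrable_const
      · exact (by fun_prop : Continuous fun l : ℝ => 1 - Real.cos (l * s)).intervalIntegrable _ _
      · intro l hl
        have hpi := Real.pi_gt_d2
        have hpi4 := Real.pi_le_four
        have hls : |l * s| ≤ Real.pi := by
          rw [abs_mul, abs_of_nonneg (by linarith [hl.1])]
          nlinarith [hl.1, hl.2, abs_nonneg s]
        have h1 := Real.cos_le_one_sub_mul_cos_sq hls
        have h2 : (1:ℝ) / 10 ≤ 2 / Real.pi ^ 2 := by
          rw [div_le_div_iff₀ (by norm_num) (by positivity)]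
          nlinarith
        have h3 : s ^ 2 ≤ (l * s) ^ 2 := by
          rw [mul_pow]
          nlinarith [sq_nonneg s, hl.1, mul_self_nonneg (l - 1)]
        have h4 : 1 / 10 * s ^ 2 ≤ 2 / Real.pi ^ 2 * (l * s) ^ 2 := by gcongr
        linarith
    rw [intervalIntegral.integral_const, smul_eq_mul] at hle
    have := min_le_right 1 (s ^ 2)
    nlinarith [sq_nonneg s]
  · push Not at hs
    have hs0 : s ≠ 0 := by
      rintro rfl
      norm_num at hs
    have hint : ∫ l in (1:ℝ)..3.1, (1 - Real.cos (l * s))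
        = 2.1 - s⁻¹ * (Real.sin (3.1 * s) - Real.sin (1 * s)) := by
      rw [intervalIntegral.integral_sub intervalIntegrable_const
        ((by fun_prop : Continuous fun l : ℝ => Real.cos (l * s)).intervalIntegrable _ _),
        intervalIntegral.integral_comp_mul_right _ hs0, integral_cos,
        intervalIntegral.integral_const]
      norm_num
    have hb : |s⁻¹ * (Real.sin (3.1 * s) - Real.sin (1 * s))| ≤ 2 := by
      rw [abs_mul, abs_inv]
      have h1 : |s|⁻¹ ≤ 1 := inv_le_one_of_one_le₀ hs.le
      have h2 : |Real.sin (3.1 * s) - Real.sin (1 * s)| ≤ 2 := by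
        have h3 := Real.neg_one_le_sin (3.1 * s)
        have h4 := Real.sin_le_one (3.1 * s)
        have h5 := Real.neg_one_le_sin (1 * s)
        have h6 := Real.sin_le_one (1 * s)
        rw [abs_le]
        constructor <;> linarith
      nlinarith [abs_nonneg (Real.sin (3.1 * s) - Real.sin (1 * s)), abs_nonneg s]
    rw [hint]
    have := min_le_left 1 (s ^ 2)
    have := (abs_le.1 hb).2
    linarith

lemma one_sub_cos_le_two_mul_min (s : ℝ) : 1 - Real.cos s ≤ 2 * min 1 (s ^ 2) := by
  have h1 := Real.neg_one_le_cos s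
  have h2 := Real.one_sub_sq_div_two_le_cos (x := s)
  rcases min_choice 1 (s ^ 2) with h | h <;> rw [h] <;> nlinarith [sq_nonneg s]

lemma min_one_sum_le_sum_min_one {ι : Type*} (s : Finset ι) (f : ι → ℝ) (hf : ∀ i, 0 ≤ f i) :
    min 1 (∑ i ∈ s, f i) ≤ ∑ i ∈ s, min 1 (f i) := by
  induction s using Finset.cons_induction with
  | empty => simp
  | cons i s hi ih =>
    rw [Finset.sum_cons, Finset.sum_cons]
    have h0 : 0 ≤ ∑ i ∈ s, f i := Finset.sum_nonneg fun i _ => hf i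
    have := hf i
    rcases min_choice 1 (∑ i ∈ s, f i) with h | h <;> rcases min_choice 1 (f i) with h' | h' <;>
      rw [h] at ih <;> rw [h'] <;>
      first
        | exact (min_le_left _ _).trans (by linarith)
        | exact (min_le_right _ _).trans (by linarith)

lemma integrable_and_integral_le_of_lintegral_ofReal_le {α : Type*} [MeasurableSpace α]
    {μ : Measure α} {f : α → ℝ} {C : ℝ} (hf : AEStronglyMeasurable f μ) (hf0 : ∀ x, 0 ≤ f x)
    (hC : 0 ≤ C) (h : ∫⁻ x, ENNReal.ofReal (f x) ∂μ ≤ ENNReal.ofReal C) :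
    Integrable f μ ∧ ∫ x, f x ∂μ ≤ C := by
  refine ⟨⟨hf, ?_⟩, ?_⟩
  · rw [hasFiniteIntegral_iff_ofReal (Eventually.of_forall hf0)]
    exact h.trans_lt ENNReal.ofReal_lt_top
  · rw [integral_eq_lintegral_of_nonneg_ae (Eventually.of_forall hf0) hf]
    exact ENNReal.toReal_le_of_le_ofReal hC h

lemma ae_cos_coord_ne_one (n : ℕ) (i : Fin n) :
    ∀ᵐ y : En n, Real.cos (y i) ≠ 1 := by
  have h : ∀ᵐ x : Fin n → ℝ, Real.cos (x i) ≠ 1 := by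
    have h1 : ∀ᵐ t : ℝ, Real.cos t ≠ 1 := by
      have hc : {t : ℝ | Real.cos t = 1}.Countable := by
        refine (countable_range fun k : ℤ => (k : ℝ) * (2 * Real.pi)).mono ?_
        intro t ht
        exact (Real.cos_eq_one_iff t).1 ht
      have := hc.measure_zero volume
      rw [ae_iff]
      simpa using this
    exact (Measure.quasiMeasurePreserving_eval (fun _ : Fin n => (volume : Measure ℝ)) i).ae h1
  exact (PiLp.volume_preserving_ofLp (Fin n)).quasiMeasurePreserving.ae h

/-- If `(1 - cos (λ y₀)) g` has integral at most `C` for every `λ ∈ [1, 3.1]`, then averaging in `λ`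
removes the zeros of the cosine weight. -/
lemma integrable_min_one_sq_mul {n : ℕ} (i : Fin n) {g : En n → ℝ} (hg0 : ∀ y, 0 ≤ g y)
    (hgm : AEMeasurable g) {C : ℝ} (hC : 0 ≤ C)
    (h : ∀ l ∈ Icc (1:ℝ) 3.1, ∫⁻ y, ENNReal.ofReal ((1 - Real.cos (l * y i)) * g y)
      ≤ ENNReal.ofReal C) :
    Integrable (fun y => min 1 (y i ^ 2) * g y) ∧ ∫ y, min 1 (y i ^ 2) * g y ≤ 21 * C := by
  have hmeas : AEMeasurable (Function.uncurry fun (l : ℝ) (y : En n) =>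
      ENNReal.ofReal ((1 - Real.cos (l * y i)) * g y))
      ((volume.restrict (Ioc (1:ℝ) 3.1)).prod volume) := by
    refine AEMeasurable.ennreal_ofReal (AEMeasurable.mul ?_ hgm.comp_snd)
    exact (by fun_prop : Continuous fun p : ℝ × En n =>
      1 - Real.cos (p.1 * p.2 i)).measurable.aemeasurable
  have hswap := lintegral_lintegral_swap hmeas
  have hleft : ∫⁻ l in Ioc (1:ℝ) 3.1, ∫⁻ y : En n, ENNReal.ofReal ((1 - Real.cos (l * y i)) * g y)
      ≤ ENNReal.ofReal (2.1 * C) := by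
    calc _ ≤ ∫⁻ _l in Ioc (1:ℝ) 3.1, ENNReal.ofReal C :=
          setLIntegral_mono' measurableSet_Ioc fun l hl => h l (Ioc_subset_Icc_self hl)
      _ = ENNReal.ofReal (2.1 * C) := by
          rw [setLIntegral_const, Real.volume_Ioc, ← ENNReal.ofReal_mul hC]
          congr 1
          ring
  have hright : ∀ y : En n, ENNReal.ofReal (min 1 (y i ^ 2) * g y / 10) ≤
      ∫⁻ l in Ioc (1:ℝ) 3.1, ENNReal.ofReal ((1 - Real.cos (l * y i)) * g y) := by
    intro y
    rw [← ofReal_integral_eq_lintegral_ofReal]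
    · rw [integral_mul_const, ← intervalIntegral.integral_of_le (by norm_num)]
      apply ENNReal.ofReal_le_ofReal
      have := mul_le_mul_of_nonneg_right (min_one_sq_le_integral_one_sub_cos (y i)) (hg0 y)
      linarith
    · exact ((by fun_prop : Continuous fun l : ℝ =>
        (1 - Real.cos (l * y i)) * g y).integrableOn_Icc).mono_set Ioc_subset_Icc_self
    · exact Eventually.of_forall fun l =>
        mul_nonneg (by linarith [Real.cos_le_one (l * y i)]) (hg0 y)
  have htot := (lintegral_mono hright).trans (hswap.symm.le.trans hleft)
  have hwm : AEMeasurable fun y : En n => min 1 (y i ^ 2) * g y :=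
    AEMeasurable.mul (by fun_prop) hgm
  have hw0 : ∀ y : En n, 0 ≤ min 1 (y i ^ 2) * g y := fun y =>
    mul_nonneg (by positivity) (hg0 y)
  obtain ⟨h1, h2⟩ := integrable_and_integral_le_of_lintegral_ofReal_le
    (hwm.div_const 10).aestronglyMeasurable (fun y => div_nonneg (hw0 y) (by norm_num))
    (by positivity) htot
  rw [integral_div] at h2
  refine ⟨?_, by linarith⟩
  have := h1.mul_const 10
  simpa using this

/-- A radial function weighted by `min 1 yᵢ²` is controlled through the weight of one coordinate. -/
lemma integrable_min_one_norm_sq_mul {n : ℕ} (i : Fin n) {G : ℝ → ℝ} (hG0 : ∀ y : En n, 0 ≤ G ‖y‖)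
    (hGm : AEMeasurable fun y : En n => G ‖y‖) {C : ℝ}
    (h : Integrable (fun y : En n => min 1 (y i ^ 2) * G ‖y‖))
    (hC : ∫ y : En n, min 1 (y i ^ 2) * G ‖y‖ ≤ C) :
    Integrable (fun y : En n => min 1 (‖y‖ ^ 2) * G ‖y‖) ∧
      ∫ y : En n, min 1 (‖y‖ ^ 2) * G ‖y‖ ≤ n * C := by
  have hcoord : ∀ j, Integrable (fun y : En n => min 1 (y j ^ 2) * G ‖y‖) ∧
      ∫ y : En n, min 1 (y j ^ 2) * G ‖y‖ ≤ C := by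
    intro j
    let e : En n ≃ₗᵢ[ℝ] En n := LinearIsometryEquiv.piLpCongrLeft 2 ℝ ℝ (Equiv.swap i j)
    have he : ∀ y : En n, (e y) i = y j := by
      intro y
      simp [e, LinearIsometryEquiv.piLpCongrLeft_apply, Equiv.piCongrLeft']
    have hmp : MeasurePreserving e := e.measurePreserving
    have hemb : MeasurableEmbedding e := e.toHomeomorph.measurableEmbedding
    have h1 := hmp.integrable_comp_emb hemb (g := fun y : En n => min 1 (y i ^ 2) * G ‖y‖)
    have h2 := hmp.integral_comp hemb (fun y : En n => min 1 (y i ^ 2) * G ‖y‖)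
    simp only [Function.comp_def, he, LinearIsometryEquiv.norm_map] at h1 h2
    exact ⟨h1.2 h, h2.le.trans hC⟩
  have hle : ∀ y : En n, min 1 (‖y‖ ^ 2) * G ‖y‖ ≤ ∑ j, min 1 (y j ^ 2) * G ‖y‖ := by
    intro y
    rw [← Finset.sum_mul, EuclideanSpace.real_norm_sq_eq]
    exact mul_le_mul_of_nonneg_right
      (min_one_sum_le_sum_min_one _ _ fun j => sq_nonneg _) (hG0 y)
  have hsum : Integrable (fun y : En n => ∑ j, min 1 (y j ^ 2) * G ‖y‖) :=
    integrable_finsetSum _ fun j _ => (hcoord j).1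
  have hint : Integrable (fun y : En n => min 1 (‖y‖ ^ 2) * G ‖y‖) := by
    refine hsum.mono' (AEMeasurable.mul (by fun_prop) hGm).aestronglyMeasurable ?_
    refine Eventually.of_forall fun y => ?_
    rw [Real.norm_of_nonneg (mul_nonneg (by positivity) (hG0 y))]
    exact hle y
  refine ⟨hint, (integral_mono hint hsum hle).trans ?_⟩
  rw [integral_finsetSum _ fun j _ => (hcoord j).1]
  calc _ ≤ ∑ _j : Fin n, C := Finset.sum_le_sum fun j _ => (hcoord j).2
    _ = n * C := by simp

lemma Cund_nonneg {φ : ℝ → ℝ} (hφ : ∀ r, 0 < r → 0 < φ r) (R : ℝ) : 0 ≤ Cund φ R :=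
  setIntegral_nonneg measurableSet_Ioo fun r hr => div_nonneg hr.1.le (hφ r hr.1).le

lemma Cov_nonneg {φ : ℝ → ℝ} (hφ : ∀ r, 0 < r → 0 < φ r) {R : ℝ} (hR : 0 ≤ R) : 0 ≤ Cov φ R :=
  setIntegral_nonneg measurableSet_Ioi fun r hr =>
    have hr0 : 0 < r := hR.trans_lt hr
    div_nonneg zero_le_one (mul_pos hr0 (hφ r hr0)).le

/-- Polar coordinates for the kernel `min 1 |y|² / (|y|ⁿ φ(|y|))`. -/
lemma integral_min_one_norm_sq_mul (n : ℕ) [NeZero n] {φ : ℝ → ℝ}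
    (h : Integrable fun y : En n => min 1 (‖y‖ ^ 2) * (‖y‖ ^ n * φ ‖y‖)⁻¹) :
    ∫ y : En n, min 1 (‖y‖ ^ 2) * (‖y‖ ^ n * φ ‖y‖)⁻¹ = n * (ωn n * (Cund φ 1 + Cov φ 1)) := by
  have hn : 1 ≤ n := Nat.one_le_iff_ne_zero.2 (NeZero.ne n)
  have : Nontrivial (En n) := by
    apply Module.nontrivial_of_finrank_pos (R := ℝ)
    simpa using Nat.pos_of_ne_zero (NeZero.ne n)
  have h1 := (integrable_fun_norm_addHaar (volume : Measure (En n))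
    (f := fun r => min 1 (r ^ 2) * (r ^ n * φ r)⁻¹)).1 h
  have h2 := integral_fun_norm_addHaar (volume : Measure (En n))
    (fun r => min 1 (r ^ 2) * (r ^ n * φ r)⁻¹)
  rw [h2]
  simp only [finrank_euclideanSpace_fin, smul_eq_mul, nsmul_eq_mul] at h1 ⊢
  have hpow : ∀ r : ℝ, r ^ n = r ^ (n - 1) * r := fun r => by
    rw [← pow_succ, Nat.sub_add_cancel hn]
  have hU : Ioi (0:ℝ) = Ioc 0 1 ∪ Ioi 1 := (Ioc_union_Ioi_eq_Ioi zero_le_one).symm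
  have hsplit := setIntegral_union (Ioc_disjoint_Ioi le_rfl) measurableSet_Ioi
    (h1.mono_set Ioc_subset_Ioi_self) (h1.mono_set (Ioi_subset_Ioi zero_le_one))
  rw [← hU] at hsplit
  rw [hsplit]
  have hA : ∫ r in Ioc (0:ℝ) 1, r ^ (n - 1) * (min 1 (r ^ 2) * (r ^ n * φ r)⁻¹) = Cund φ 1 := by
    rw [integral_Ioc_eq_integral_Ioo, Cund]
    refine setIntegral_congr_fun measurableSet_Ioo fun r hr => ?_
    have hr0 : r ≠ 0 := hr.1.ne'
    have hm : min 1 (r ^ 2) = r ^ 2 := min_eq_right (by nlinarith [hr.1, hr.2])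
    simp only [hm, hpow]
    by_cases hφ : φ r = 0
    · simp [hφ]
    · field_simp
  have hB : ∫ r in Ioi (1:ℝ), r ^ (n - 1) * (min 1 (r ^ 2) * (r ^ n * φ r)⁻¹) = Cov φ 1 := by
    rw [Cov]
    refine setIntegral_congr_fun measurableSet_Ioi fun r hr => ?_
    have hr1 : (1:ℝ) < r := hr
    have hr0 : r ≠ 0 := by linarith
    have hm : min 1 (r ^ 2) = 1 := min_eq_left (by nlinarith)
    simp only [hm, hpow]
    by_cases hφ : φ r = 0
    · simp [hφ]
    · field_simp
  rw [hA, hB]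
  rfl

/-- The scaling bound `φ(λr) ≤ 10 a φ(r)` for `λ ∈ [1, 3.1]`. -/
lemma WSC.le_mul_of_mem_Icc {φ : ℝ → ℝ} {a σl σu : ℝ} (h : WSC φ a σl σu) (ha : 1 ≤ a)
    (hσ : σu < 2) {l r : ℝ} (hl : l ∈ Icc (1:ℝ) 3.1) (hr : 0 < r) :
    φ (l * r) ≤ 10 * a * φ r := by
  have h1 := (h.2 r (l * r) hr (by nlinarith [hl.1])).2
  rw [mul_div_cancel_right₀ _ hr.ne', div_le_iff₀ (h.1 r hr)] at h1
  have h2 : l ^ σu ≤ 10 := by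
    calc l ^ σu ≤ l ^ (2:ℝ) := Real.rpow_le_rpow_of_exponent_le hl.1 hσ.le
      _ = l ^ 2 := Real.rpow_two l
      _ ≤ 10 := by nlinarith [hl.1, hl.2]
  refine h1.trans ?_
  have := (h.1 r hr).le
  rw [mul_comm 10 a]
  gcongr

lemma integral_min_one_norm_sq_le (n : ℕ) [NeZero n] {φ : ℝ → ℝ} {a σl σu : ℝ} (ha : 1 ≤ a)
    (hσ : σu < 2) (h : WSC φ a σl σu)
    (hf : Integrable fun y : En n => (1 - Real.cos (y 0)) / (‖y‖ ^ n * φ ‖y‖)) :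
    (Integrable fun y : En n => min 1 (‖y‖ ^ 2) * (‖y‖ ^ n * φ ‖y‖)⁻¹) ∧
    ∫ y : En n, min 1 (‖y‖ ^ 2) * (‖y‖ ^ n * φ ‖y‖)⁻¹ ≤
      n * (210 * a * ∫ y : En n, (1 - Real.cos (y 0)) / (‖y‖ ^ n * φ ‖y‖)) := by
  set f : En n → ℝ := fun y => (1 - Real.cos (y 0)) / (‖y‖ ^ n * φ ‖y‖) with hfdef
  have hn : n ≠ 0 := NeZero.ne n
  have hg0 : ∀ y : En n, 0 ≤ (‖y‖ ^ n * φ ‖y‖)⁻¹ := by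
    intro y
    rcases (norm_nonneg y).eq_or_lt with hy | hy
    · simp [← hy, hn]
    · have := h.1 _ hy
      positivity
  have hcos : ∀ t : ℝ, 0 ≤ 1 - Real.cos t := fun t => by linarith [Real.cos_le_one t]
  have hf0 : ∀ y, 0 ≤ f y := fun y => mul_nonneg (hcos _) (hg0 y)
  have hgm : AEMeasurable fun y : En n => (‖y‖ ^ n * φ ‖y‖)⁻¹ := by
    have hdiv : AEMeasurable fun y : En n => f y / (1 - Real.cos (y 0)) :=
      hf.aemeasurable.div
        (by fun_prop : Continuous fun y : En n => 1 - Real.cos (y 0)).measurable.aemeasurable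
    refine hdiv.congr ?_
    filter_upwards [ae_cos_coord_ne_one n 0] with y hy
    have : 1 - Real.cos (y 0) ≠ 0 := sub_ne_zero.2 hy.symm
    simp only [hfdef]
    rw [div_div_cancel_left' this]
  have hI : 0 ≤ ∫ y, f y := integral_nonneg hf0
  have hbound : ∀ l ∈ Icc (1:ℝ) 3.1,
      ∫⁻ y : En n, ENNReal.ofReal ((1 - Real.cos (l * y 0)) * (‖y‖ ^ n * φ ‖y‖)⁻¹)
        ≤ ENNReal.ofReal (10 * a * ∫ y, f y) := by
    intro l hl
    have hl0 : 0 < l := by linarith [hl.1]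
    have hint : Integrable fun y : En n => 10 * a * l ^ n * f (l • y) :=
      ((integrable_comp_smul_iff volume f hl0.ne').2 hf).const_mul _
    have heq : ∫ y : En n, 10 * a * l ^ n * f (l • y) = 10 * a * ∫ y, f y := by
      rw [integral_const_mul, Measure.integral_comp_smul_of_nonneg volume f l (hR := hl0.le),
        finrank_euclideanSpace_fin, smul_eq_mul]
      field_simp
    rw [← heq, ofReal_integral_eq_lintegral_ofReal hint
      (Eventually.of_forall fun y => mul_nonneg (by positivity) (hf0 _))]
    refine lintegral_mono fun y => ENNReal.ofReal_le_ofReal ?_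
    rcases (norm_nonneg y).eq_or_lt with hy | hy
    · have hy' : y = 0 := norm_eq_zero.1 hy.symm
      simp [hy', hfdef]
    · have h1 := h.le_mul_of_mem_Icc ha hσ hl hy
      have h2 := h.1 _ hy
      have h3 := h.1 _ (mul_pos hl0 hy)
      have h4 : (φ ‖y‖)⁻¹ ≤ 10 * a * (φ (l * ‖y‖))⁻¹ := by
        rw [← div_eq_mul_inv, inv_eq_one_div, div_le_div_iff₀ h2 h3]
        linarith
      have h5 : 10 * a * l ^ n * f (l • y)
          = (1 - Real.cos (l * y 0)) * ((‖y‖ ^ n)⁻¹ * (10 * a * (φ (l * ‖y‖))⁻¹)) := by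
        simp only [hfdef, norm_smul, Real.norm_of_nonneg hl0.le, PiLp.smul_apply, smul_eq_mul,
          mul_pow]
        field_simp
      rw [h5, mul_inv]
      have := hcos (l * y 0)
      gcongr
  obtain ⟨h1, h2⟩ := integrable_min_one_sq_mul 0 hg0 hgm (by positivity) hbound
  obtain ⟨h3, h4⟩ := integrable_min_one_norm_sq_mul 0 (G := fun r => (r ^ n * φ r)⁻¹)
    hg0 hgm h1 h2
  refine ⟨h3, h4.trans_eq ?_⟩
  ring

theorem stmt8 (n : ℕ) [NeZero n] :
    ∃ c₂ > (0:ℝ), ∀ (φ : ℝ → ℝ) (a σl σu : ℝ), 1 ≤ a → 0 < σl → σl ≤ σu → σu < 2 →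
      WSC φ a σl σu →
        Cphi n φ ≤ a * c₂ / (Cund φ 1 + Cov φ 1) := by
  have hω : 0 < ωn n :=
    ENNReal.toReal_pos (measure_ball_pos _ _ one_pos).ne' measure_ball_lt_top.ne
  refine ⟨210 / ωn n, by positivity, fun φ a σl σu ha _ _ hσ h => ?_⟩
  have hS : 0 ≤ Cund φ 1 + Cov φ 1 :=
    add_nonneg (Cund_nonneg h.1 1) (Cov_nonneg h.1 zero_le_one)
  have hrhs : 0 ≤ a * (210 / ωn n) / (Cund φ 1 + Cov φ 1) := by positivity
  by_cases hf : Integrable fun y : En n => (1 - Real.cos (y 0)) / (‖y‖ ^ n * φ ‖y‖)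
  swap
  · rw [Cphi, integral_undef hf, inv_zero]
    exact hrhs
  obtain ⟨hK, hle⟩ := integral_min_one_norm_sq_le n ha hσ h hf
  have hg0 : ∀ y : En n, 0 ≤ (‖y‖ ^ n * φ ‖y‖)⁻¹ := by
    intro y
    rcases (norm_nonneg y).eq_or_lt with hy | hy
    · simp [← hy, NeZero.ne n]
    · have := h.1 _ hy
      positivity
  have hge : ∫ y : En n, (1 - Real.cos (y 0)) / (‖y‖ ^ n * φ ‖y‖) ≤
      2 * ∫ y : En n, min 1 (‖y‖ ^ 2) * (‖y‖ ^ n * φ ‖y‖)⁻¹ := by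
    rw [← integral_const_mul]
    refine integral_mono hf (hK.const_mul 2) fun y => ?_
    simp only [div_eq_mul_inv, ← mul_assoc]
    refine mul_le_mul_of_nonneg_right ((one_sub_cos_le_two_mul_min (y 0)).trans ?_) (hg0 y)
    have h1 : y 0 ^ 2 ≤ ‖y‖ ^ 2 := by
      rw [EuclideanSpace.real_norm_sq_eq]
      exact Finset.single_le_sum (f := fun i => y i ^ 2) (fun i _ => sq_nonneg _)
        (Finset.mem_univ 0)
    gcongr
  rw [integral_min_one_norm_sq_mul n hK] at hle hge
  rw [Cphi]
  set I := ∫ y : En n, (1 - Real.cos (y 0)) / (‖y‖ ^ n * φ ‖y‖)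
  rcases le_or_gt I 0 with hI | hI
  · exact (inv_nonpos.2 hI).trans hrhs
  have hn : (0:ℝ) < n := Nat.cast_pos.2 (Nat.pos_of_ne_zero (NeZero.ne n))
  have hle' := le_of_mul_le_mul_left hle hn
  have hSpos : 0 < Cund φ 1 + Cov φ 1 := by
    refine hS.lt_of_ne fun h0 => ?_
    rw [← h0] at hge
    simp only [mul_zero] at hge
    linarith
  rw [inv_eq_one_div, div_le_div_iff₀ hI hSpos]
  rw [← mul_div_assoc, div_mul_eq_mul_div, le_div_iff₀ hω]
  linarith
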